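/- arXiv:1602.02964 — 5 statements merged into one kernel-verified Lean document; each statement's English description precedes it below -/
import Mathlib

section
/- Let g : ℝ^d → ℝ be differentiable, and fix a coordinate index i. Assume the i-th partial derivative ∂g/∂x_i is Lebesgue integrable on ℝ^d, and that for Lebesgue-almost every fixed value of the remaining d−1 coordinates, g(x) → 0 as x_i → +∞ and as x_i → −∞. Then ∫_{ℝ^d} (∂g/∂x_i)(x) dx = 0. -/
open MeasureTheory Filter

/-- If `g : ℝ^d → ℝ` is differentiable, its `i`-th partial derivative is
Lebesgue integrable, and for a.e. fixed value of the remaining coordinates `g` tends to `0`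
as the `i`-th coordinate tends to `±∞`, then the integral of the `i`-th partial derivative
over `ℝ^d` vanishes. -/
theorem integral_partial_deriv_eq_zero {d : ℕ} (g : (Fin d → ℝ) → ℝ) (i : Fin d)
    (hg : Differentiable ℝ g)
    (hint : Integrable (fun x => fderiv ℝ g x (Pi.single i 1)) volume)
    (hlim : ∀ᵐ x ∂(volume : Measure (Fin d → ℝ)),
      Tendsto (fun t : ℝ => g (Function.update x i t)) atTop (nhds 0) ∧
      Tendsto (fun t : ℝ => g (Function.update x i t)) atBot (nhds 0)) :
    ∫ x, fderiv ℝ g x (Pi.single i 1) = 0 := by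
  obtain ⟨n, rfl⟩ : ∃ n, d = n + 1 := ⟨d - 1, by have := i.pos; omega⟩
  have hmp := (volume_preserving_piFinSuccAbove (fun _ : Fin (n + 1) => ℝ) i).symm
  have hsymm : ∀ z : ℝ × (Fin n → ℝ),
      (MeasurableEquiv.piFinSuccAbove (fun _ : Fin (n + 1) => ℝ) i).symm z =
        i.insertNth (α := fun _ => ℝ) z.1 z.2 := fun _ => rfl
  have hint' := (hmp.integrable_comp_emb (MeasurableEquiv.measurableEmbedding _)).2 hint
  have hlim' := (Measure.measurePreserving_swap (μ := (volume : Measure (Fin n → ℝ)))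
    (ν := (volume : Measure ℝ))).quasiMeasurePreserving.ae
      (hmp.quasiMeasurePreserving.ae hlim)
  rw [← hmp.integral_comp (MeasurableEquiv.measurableEmbedding _)]
  refine (integral_prod_symm _ hint').trans (integral_eq_zero_of_ae ?_)
  filter_upwards [hint'.prod_left_ae, Measure.ae_ae_of_ae_prod hlim'] with y hy hs
  obtain ⟨s, hs⟩ := hs.exists
  simp only [Prod.swap_prod_mk, hsymm, Fin.update_insertNth] at hs
  simp only [hsymm, Function.comp_apply] at hy ⊢
  have hderiv : ∀ t : ℝ, HasDerivAt (fun t : ℝ => g (i.insertNth (α := fun _ => ℝ) t y))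
      (fderiv ℝ g (i.insertNth (α := fun _ => ℝ) t y) (Pi.single i 1)) t := by
    intro t
    have hline := hasDerivAt_update (i.insertNth (α := fun _ => ℝ) t y) i t
    simp only [funext fun u => Fin.update_insertNth (α := fun _ => ℝ) i t u y] at hline
    exact (hg _).hasFDerivAt.comp_hasDerivAt t hline
  simpa using integral_of_hasDerivAt_of_tendsto hderiv hy hs.2 hs.1
end

section
/- Let p : ℝ^d → ℝ be a strictly positive, continuously differentiable probability density with respect to Lebesgue measure, and fix a coordinate index i. Let f : ℝ^d → ℝ be continuously differentiable such that the function x ↦ ∂(p·f)/∂x_i(x) is Lebesgue integrable on ℝ^d, and such that for Lebesgue-almost every fixed value of the remaining d−1 coordinates, p(x) f(x) → 0 as x_i → ±∞. Then ∫_{ℝ^d} [ (∂ log p(x)/∂x_i) f(x) + (∂f(x)/∂x_i) ] p(x) dx = 0; that is, the Stein operator applied to f has zero expectation in the i-th coordinate under the density p. -/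
open MeasureTheory Filter

/-- A differentiable function on `ℝ^d` whose `i`-th partial derivative is integrable, and which
vanishes at both ends of almost every line parallel to the `i`-th axis, has an `i`-th partial
derivative of integral zero. -/
theorem integral_fderiv_single_eq_zero {d : ℕ} {g : (Fin d → ℝ) → ℝ} (i : Fin d)
    (hg : Differentiable ℝ g)
    (hint : Integrable (fun x => fderiv ℝ g x (Pi.single i 1)))
    (hlim : ∀ᵐ x ∂(volume : Measure (Fin d → ℝ)),
      Tendsto (fun t : ℝ => g (Function.update x i t)) atTop (nhds 0) ∧
      Tendsto (fun t : ℝ => g (Function.update x i t)) atBot (nhds 0)) :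
    ∫ x, fderiv ℝ g x (Pi.single i 1) = 0 := by
  obtain _ | n := d
  · exact i.elim0
  have he := (volume_preserving_piFinSuccAbove (fun _ : Fin (n + 1) => ℝ) i).symm
  have hsymm (z : ℝ × (Fin n → ℝ)) :
      (MeasurableEquiv.piFinSuccAbove (fun _ : Fin (n + 1) => ℝ) i).symm z =
        Fin.insertNth (α := fun _ => ℝ) i z.1 z.2 := rfl
  have hint' := (he.integrable_comp_emb (MeasurableEquiv.measurableEmbedding _)).2 hint
  have hlim' := Measure.ae_ae_of_ae_prod
    (Measure.measurePreserving_swap.quasiMeasurePreserving.ae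
      (he.quasiMeasurePreserving.ae hlim))
  rw [← he.integral_comp' (g := fun x => fderiv ℝ g x (Pi.single i 1))]
  rw [Measure.volume_eq_prod] at hint' ⊢
  refine (integral_prod_symm _ hint').trans (integral_eq_zero_of_ae ?_)
  filter_upwards [hint'.prod_left_ae, hlim'] with y hy hly
  obtain ⟨s, hs⟩ := hly.exists
  simp only [hsymm, Prod.fst_swap, Prod.snd_swap, Fin.update_insertNth] at hs
  have hderiv (t : ℝ) : HasDerivAt (fun t => g (Fin.insertNth (α := fun _ => ℝ) i t y))
      (fderiv ℝ g (Fin.insertNth (α := fun _ => ℝ) i t y) (Pi.single i 1)) t := by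
    have hupd : Function.update (Fin.insertNth (α := fun _ => ℝ) i s y) i =
        fun t => Fin.insertNth (α := fun _ => ℝ) i t y :=
      funext fun t => Fin.update_insertNth (α := fun _ => ℝ) i s t y
    have h := hasDerivAt_update (𝕜 := ℝ) (Fin.insertNth (α := fun _ => ℝ) i s y) i t
    rw [hupd] at h
    exact (hg _).hasFDerivAt.comp_hasDerivAt t h
  exact (integral_of_hasDerivAt_of_tendsto hderiv hy hs.2 hs.1).trans (sub_self 0)

/-- For a strictly positive `C¹` probability density `p` on `ℝ^d` and a `C¹`
function `f`, if `∂(p·f)/∂xᵢ` is Lebesgue integrable and `p·f` vanishes at `±∞` in the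
`i`-th coordinate for a.e. fixed value of the remaining coordinates, then the `i`-th
coordinate of the Stein operator applied to `f` has zero expectation under `p`. -/
theorem stein_coordinate_expectation_zero {d : ℕ} (p f : (Fin d → ℝ) → ℝ) (i : Fin d)
    (hp_pos : ∀ x, 0 < p x) (hp_smooth : ContDiff ℝ 1 p)
    (hp_dens : ∫ x, p x = 1)
    (hf : ContDiff ℝ 1 f)
    (hint : Integrable (fun x => fderiv ℝ (fun y => p y * f y) x (Pi.single i 1)) volume)
    (hlim : ∀ᵐ x ∂(volume : Measure (Fin d → ℝ)),
      Tendsto (fun t : ℝ => p (Function.update x i t) * f (Function.update x i t))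
        atTop (nhds 0) ∧
      Tendsto (fun t : ℝ => p (Function.update x i t) * f (Function.update x i t))
        atBot (nhds 0)) :
    ∫ x, (fderiv ℝ (fun y => Real.log (p y)) x (Pi.single i 1) * f x
      + fderiv ℝ f x (Pi.single i 1)) * p x = 0 := by
  rw [← integral_fderiv_single_eq_zero i
    ((hp_smooth.mul hf).differentiable one_ne_zero) hint hlim]
  congr 1 with x
  have hp := hp_smooth.differentiable one_ne_zero x
  rw [fderiv.log hp (hp_pos x).ne', fderiv_fun_mul hp (hf.differentiable one_ne_zero x)]
  have := (hp_pos x).ne'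
  simp only [add_apply, smul_apply, smul_eq_mul]
  field_simp
  ring
end

section
/- Let H be a real Hilbert space and φ : ℝ^d → H a continuously differentiable map, defining the kernel k(x,y) = ⟨φ(x), φ(y)⟩_H. Let p : ℝ^d → ℝ be a strictly positive, differentiable density, and define ξ_p(x) ∈ H^d with i-th component ξ_{p,i}(x) = (∂ log p(x)/∂x_i) φ(x) + ∂φ(x)/∂x_i. Then for all x, y ∈ ℝ^d, the inner product ⟨ξ_p(x), ξ_p(y)⟩_{H^d} = Σ_{i=1}^d ⟨ξ_{p,i}(x), ξ_{p,i}(y)⟩_H equals h_p(x,y) := ∇log p(x)ᵀ ∇log p(y) k(x,y) + ∇log p(y)ᵀ ∇_x k(x,y) + ∇log p(x)ᵀ ∇_y k(x,y) + Σ_{i=1}^d ∂²k(x,y)/∂x_i ∂y_i. -/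
open MeasureTheory Filter
open scoped RealInnerProductSpace BigOperators

/-- The `i`-th partial derivative of `log p` at `x`. -/
noncomputable def dlog {d : ℕ} (p : (Fin d → ℝ) → ℝ) (x : Fin d → ℝ) (i : Fin d) : ℝ :=
  fderiv ℝ (fun y => Real.log (p y)) x (Pi.single i 1)

/-- The `i`-th component of the Stein feature `ξ_p(x) ∈ H^d`:
`ξ_{p,i}(x) = (∂ log p(x)/∂xᵢ) φ(x) + ∂φ(x)/∂xᵢ`. -/
noncomputable def steinFeat {d : ℕ} {H : Type*} [NormedAddCommGroup H]
    [InnerProductSpace ℝ H] (φ : (Fin d → ℝ) → H) (p : (Fin d → ℝ) → ℝ)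
    (x : Fin d → ℝ) (i : Fin d) : H :=
  dlog p x i • φ x + fderiv ℝ φ x (Pi.single i 1)

theorem fderiv_inner_const_apply {E H : Type*} [NormedAddCommGroup E] [NormedSpace ℝ E]
    [NormedAddCommGroup H] [InnerProductSpace ℝ H] {f : E → H} {x : E}
    (hf : DifferentiableAt ℝ f x) (c : H) (v : E) :
    fderiv ℝ (fun z => ⟪f z, c⟫) x v = ⟪fderiv ℝ f x v, c⟫ := by
  simp [fderiv_inner_apply ℝ hf (differentiableAt_const c)]

theorem fderiv_const_inner_apply {E H : Type*} [NormedAddCommGroup E] [NormedSpace ℝ E]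
    [NormedAddCommGroup H] [InnerProductSpace ℝ H] {f : E → H} {x : E}
    (hf : DifferentiableAt ℝ f x) (c : H) (v : E) :
    fderiv ℝ (fun z => ⟪c, f z⟫) x v = ⟪c, fderiv ℝ f x v⟫ := by
  simp [fderiv_inner_apply ℝ (differentiableAt_const c) hf]

/-- the inner product `⟪ξ_p(x), ξ_p(y)⟫_{H^d} = ∑ᵢ ⟪ξ_{p,i}(x), ξ_{p,i}(y)⟫`
equals the Stein kernel
`h_p(x,y) = ∇log p(x)ᵀ∇log p(y) k(x,y) + ∇log p(y)ᵀ∇ₓk(x,y) + ∇log p(x)ᵀ∇_y k(x,y)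
  + ∑ᵢ ∂²k(x,y)/∂xᵢ∂yᵢ` where `k(x,y) = ⟪φ x, φ y⟫`. -/
theorem stein_feature_inner_eq_stein_kernel {d : ℕ} {H : Type*} [NormedAddCommGroup H]
    [InnerProductSpace ℝ H]
    (φ : (Fin d → ℝ) → H) (hφ : ContDiff ℝ 1 φ)
    (p : (Fin d → ℝ) → ℝ) (hp_pos : ∀ x, 0 < p x) (hp_diff : Differentiable ℝ p)
    (hp_dens : ∫ x, p x = 1)
    (x y : Fin d → ℝ) :
    ∑ i, ⟪steinFeat φ p x i, steinFeat φ p y i⟫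
      = (∑ i, dlog p x i * dlog p y i) * ⟪φ x, φ y⟫
        + ∑ i, dlog p y i * fderiv ℝ (fun x' => ⟪φ x', φ y⟫) x (Pi.single i 1)
        + ∑ i, dlog p x i * fderiv ℝ (fun y' => ⟪φ x, φ y'⟫) y (Pi.single i 1)
        + ∑ i, fderiv ℝ
            (fun y' => fderiv ℝ (fun x' => ⟪φ x', φ y'⟫) x (Pi.single i 1)) y
            (Pi.single i 1) := by
  have hd : Differentiable ℝ φ := hφ.differentiable one_ne_zero
  simp only [fderiv_inner_const_apply (hd x), fderiv_const_inner_apply (hd y),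
    Finset.sum_mul, ← Finset.sum_add_distrib]
  refine Finset.sum_congr rfl fun i _ => ?_
  simp only [steinFeat, inner_add_left, inner_add_right, real_inner_smul_left,
    real_inner_smul_right]
  ring
end

section
/- Let H be a real Hilbert space, φ : ℝ^d → H continuously differentiable, p : ℝ^d → ℝ a strictly positive differentiable density, and define ξ_p(x) ∈ H^d with components ξ_{p,i}(x) = (∂ log p(x)/∂x_i) φ(x) + ∂φ(x)/∂x_i, and h_p(x,y) = ⟨ξ_p(x), ξ_p(y)⟩_{H^d}. Let q be a Borel probability measure on ℝ^d such that ξ_p is strongly measurable and ∫ h_p(z,z) dq(z) < ∞. Then ξ_p is Bochner integrable with respect to q, and ‖∫ ξ_p(z) dq(z)‖²_{H^d} = ∫∫ h_p(z,z') dq(z) dq(z'), i.e., the squared Stein discrepancy equals the expectation of h_p over two independent draws from q. -/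
open MeasureTheory Filter
open scoped RealInnerProductSpace BigOperators

/-- The Stein feature `ξ_p(x)` as an element of the product Hilbert space `H^d`
(with inner product `⟪f,g⟫ = ∑ᵢ ⟪fᵢ,gᵢ⟫`), with `i`-th component
`ξ_{p,i}(x) = (∂ log p(x)/∂xᵢ) φ(x) + ∂φ(x)/∂xᵢ`. -/
noncomputable def steinXi {d : ℕ} {H : Type*} [NormedAddCommGroup H]
    [InnerProductSpace ℝ H] (φ : (Fin d → ℝ) → H) (p : (Fin d → ℝ) → ℝ)
    (x : Fin d → ℝ) : PiLp 2 (fun _ : Fin d => H) :=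
  (WithLp.equiv 2 (∀ _ : Fin d, H)).symm fun i =>
    (fderiv ℝ (fun y => Real.log (p y)) x (Pi.single i 1)) • φ x
      + fderiv ℝ φ x (Pi.single i 1)

/-- A strongly measurable function with integrable squared norm is integrable with respect to a
finite measure. -/
theorem integrable_of_integrable_inner_self {α E : Type*} [MeasurableSpace α]
    [NormedAddCommGroup E] [InnerProductSpace ℝ E] {μ : Measure α} [IsFiniteMeasure μ]
    {f : α → E} (hf : AEStronglyMeasurable f μ) (hint : Integrable (fun z => ⟪f z, f z⟫) μ) :
    Integrable f μ := by
  simp only [real_inner_self_eq_norm_sq] at hint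
  exact ((memLp_two_iff_integrable_sq_norm hf).2 hint).integrable one_le_two

/-- The squared norm of a Bochner integral is the iterated integral of the inner product. -/
theorem norm_integral_sq_eq_integral_inner {α E : Type*} [MeasurableSpace α]
    [NormedAddCommGroup E] [InnerProductSpace ℝ E] [CompleteSpace E] {μ : Measure α}
    {f : α → E} (hf : Integrable f μ) :
    ‖∫ z, f z ∂μ‖ ^ 2 = ∫ z, ∫ z', ⟪f z, f z'⟫ ∂μ ∂μ := by
  simp_rw [integral_inner hf, real_inner_comm (∫ z, f z ∂μ)]
  rw [integral_inner hf, real_inner_self_eq_norm_sq]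

/-- Theorem 1 of the paper: if `ξ_p` is strongly measurable and
`∫ h_p(z,z) dq(z) < ∞` (where `h_p(x,y) = ⟪ξ_p x, ξ_p y⟫_{H^d}`), then `ξ_p` is Bochner
integrable w.r.t. `q` and the squared Stein discrepancy `‖∫ ξ_p dq‖²` equals
`∫∫ h_p(z,z') dq(z) dq(z')`. -/
theorem squared_stein_discrepancy_eq {d : ℕ} {H : Type*} [NormedAddCommGroup H]
    [InnerProductSpace ℝ H] [CompleteSpace H]
    (φ : (Fin d → ℝ) → H) (hφ : ContDiff ℝ 1 φ)
    (p : (Fin d → ℝ) → ℝ) (hp_pos : ∀ x, 0 < p x) (hp_diff : Differentiable ℝ p)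
    (hp_dens : ∫ x, p x = 1)
    (q : Measure (Fin d → ℝ)) [IsProbabilityMeasure q]
    (hmeas : StronglyMeasurable (steinXi φ p))
    (hint : Integrable (fun z => ⟪steinXi φ p z, steinXi φ p z⟫) q) :
    Integrable (steinXi φ p) q ∧
    ‖∫ z, steinXi φ p z ∂q‖ ^ 2 = ∫ z, ∫ z', ⟪steinXi φ p z, steinXi φ p z'⟫ ∂q ∂q := by
  have hf : Integrable (steinXi φ p) q :=
    integrable_of_integrable_inner_self hmeas.aestronglyMeasurable hint
  exact ⟨hf, norm_integral_sq_eq_integral_inner hf⟩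
end

section
/- Let H be a real Hilbert space, φ : ℝ^d → H continuously differentiable with kernel k(x,y) = ⟨φ(x), φ(y)⟩_H, p : ℝ^d → ℝ a strictly positive continuously differentiable probability density, and ξ_p(x) ∈ H^d with components ξ_{p,i}(x) = (∂ log p(x)/∂x_i) φ(x) + ∂φ(x)/∂x_i. Assume ξ_p is Bochner integrable with respect to the measure p(x)dx, and assume that for every h ∈ H and every coordinate i, the function f_h(x) = ⟨h, φ(x)⟩ satisfies: ∂(p·f_h)/∂x_i is Lebesgue integrable and p(x) f_h(x) → 0 as x_i → ±∞ for almost every fixed value of the other coordinates. Then ∫ ξ_p(x) p(x) dx = 0 in H^d. -/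
open MeasureTheory Filter
open scoped RealInnerProductSpace BigOperators

/-- A function on `ℝ^d` whose `i`-th partial derivative is integrable, and which vanishes at `±∞`
along almost every line in the `i`-th direction, has an `i`-th partial derivative of integral
zero. -/
theorem integral_fderiv_single_eq_zero_of_tendsto {d : ℕ} {E : Type*} [NormedAddCommGroup E]
    [NormedSpace ℝ E] [CompleteSpace E] {f : (Fin d → ℝ) → E} (hf : Differentiable ℝ f) (i : Fin d)
    (hint : Integrable (fun x => fderiv ℝ f x (Pi.single i 1)))
    (hlim : ∀ᵐ x ∂(volume : Measure (Fin d → ℝ)),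
      Tendsto (fun t : ℝ => f (Function.update x i t)) atTop (nhds 0) ∧
      Tendsto (fun t : ℝ => f (Function.update x i t)) atBot (nhds 0)) :
    ∫ x, fderiv ℝ f x (Pi.single i 1) = 0 := by
  obtain _ | n := d
  · exact i.elim0
  have he := (volume_preserving_piFinSuccAbove (fun _ : Fin (n + 1) => ℝ) i).symm
  have hlim' := he.quasiMeasurePreserving.ae hlim
  have hint' := (he.integrable_comp_emb (MeasurableEquiv.measurableEmbedding _)).2 hint
  rw [← he.integral_comp (MeasurableEquiv.measurableEmbedding _)]
  rw [Measure.volume_eq_prod] at hlim' hint' ⊢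
  refine (integral_prod_symm _ hint').trans ?_
  obtain ⟨s, hs⟩ := (Measure.ae_ae_of_ae_prod hlim').exists
  refine integral_eq_zero_of_ae ?_
  filter_upwards [hs, hint'.prod_left_ae] with y hy hy_int
  simp only [MeasurableEquiv.piFinSuccAbove_symm_apply, Fin.insertNthEquiv, Equiv.coe_fn_mk,
    Fin.update_insertNth, Function.comp_def] at hy hy_int ⊢
  have hderiv (t : ℝ) : HasDerivAt (fun t => f (i.insertNth (α := fun _ => ℝ) t y))
      (fderiv ℝ f (i.insertNth (α := fun _ => ℝ) t y) (Pi.single i 1)) t := by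
    have h := hasDerivAt_update (i.insertNth (α := fun _ => ℝ) 0 y) i t
    have h' := (hf (Function.update (i.insertNth (α := fun _ => ℝ) 0 y) i t)).hasFDerivAt
      |>.comp_hasDerivAt t h
    simpa only [Function.comp_def, Fin.update_insertNth] using h'
  simpa using integral_of_hasDerivAt_of_tendsto hderiv hy_int hy.2 hy.1

theorem inner_smul_steinXi_eq_fderiv {d : ℕ} {H : Type*} [NormedAddCommGroup H]
    [InnerProductSpace ℝ H] {φ : (Fin d → ℝ) → H} {p : (Fin d → ℝ) → ℝ} {x : Fin d → ℝ}
    (hφ : DifferentiableAt ℝ φ x) (hp : DifferentiableAt ℝ p x) (hpx : p x ≠ 0)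
    (h : H) (i : Fin d) :
    ⟪h, p x • steinXi φ p x i⟫ = fderiv ℝ (fun y => p y * ⟪h, φ y⟫) x (Pi.single i 1) := by
  have hinner : HasFDerivAt (fun y => ⟪h, φ y⟫) ((innerSL ℝ h).comp (fderiv ℝ φ x)) x :=
    (innerSL ℝ h).hasFDerivAt.comp x hφ.hasFDerivAt
  rw [(hp.hasFDerivAt.fun_mul hinner).fderiv]
  simp only [steinXi, WithLp.equiv_symm_apply, fderiv.log hp hpx, inner_smul_right,
    inner_add_right, add_apply, smul_apply,
    ContinuousLinearMap.comp_apply, innerSL_apply_apply, smul_eq_mul]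
  field_simp
  ring

/-- degeneracy of the Stein feature under the target density: if `ξ_p` is
Bochner integrable w.r.t. the measure `p(x)dx` and for every `h ∈ H` and coordinate `i`
the function `f_h(x) = ⟪h, φ x⟫` satisfies that `∂(p·f_h)/∂xᵢ` is Lebesgue integrable and
`p·f_h` vanishes at `±∞` in the `i`-th coordinate (a.e. in the remaining coordinates),
then `∫ ξ_p(x) p(x) dx = 0` in `H^d`. -/
theorem stein_feature_mean_zero_under_target {d : ℕ} {H : Type*} [NormedAddCommGroup H]
    [InnerProductSpace ℝ H] [CompleteSpace H]
    (φ : (Fin d → ℝ) → H) (hφ : ContDiff ℝ 1 φ)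
    (p : (Fin d → ℝ) → ℝ) (hp_pos : ∀ x, 0 < p x) (hp_smooth : ContDiff ℝ 1 p)
    (hp_dens : ∫ x, p x = 1)
    (hint : Integrable (steinXi φ p) (volume.withDensity fun x => ENNReal.ofReal (p x)))
    (hcond : ∀ (h : H) (i : Fin d),
      Integrable
        (fun x => fderiv ℝ (fun y => p y * ⟪h, φ y⟫) x (Pi.single i 1)) volume ∧
      ∀ᵐ x ∂(volume : Measure (Fin d → ℝ)),
        Tendsto (fun t : ℝ => p (Function.update x i t) * ⟪h, φ (Function.update x i t)⟫)
          atTop (nhds 0) ∧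
        Tendsto (fun t : ℝ => p (Function.update x i t) * ⟪h, φ (Function.update x i t)⟫)
          atBot (nhds 0)) :
    ∫ x, steinXi φ p x ∂(volume.withDensity fun x => ENNReal.ofReal (p x)) = 0 := by
  have hpm : Measurable fun x => ENNReal.ofReal (p x) :=
    hp_smooth.continuous.measurable.ennreal_ofReal
  have hlt : ∀ᵐ x : Fin d → ℝ, ENNReal.ofReal (p x) < ⊤ := ae_of_all _ fun _ => by simp
  have htoReal (x : Fin d → ℝ) : (ENNReal.ofReal (p x)).toReal = p x :=
    ENNReal.toReal_ofReal (hp_pos x).le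
  rw [integrable_withDensity_iff_integrable_smul' hpm hlt] at hint
  rw [integral_withDensity_eq_integral_toReal_smul hpm hlt]
  simp only [htoReal] at hint ⊢
  ext i
  refine ext_inner_left ℝ fun h => ?_
  have hcomm := ((innerSL ℝ h).comp
    (PiLp.proj (𝕜 := ℝ) 2 (fun _ : Fin d => H) i)).integral_comp_comm hint
  simp only [ContinuousLinearMap.comp_apply, innerSL_apply_apply, PiLp.proj_apply,
    PiLp.smul_apply] at hcomm
  have hφd := hφ.differentiable one_ne_zero
  have hpd := hp_smooth.differentiable one_ne_zero
  rw [← hcomm, PiLp.zero_apply, inner_zero_right]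
  simp only [inner_smul_steinXi_eq_fderiv (hφd _) (hpd _) (hp_pos _).ne']
  exact integral_fderiv_single_eq_zero_of_tendsto
    (hpd.mul ((innerSL ℝ h).differentiable.comp hφd)) i (hcond h i).1 (hcond h i).2
end
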